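/- Let φ : S → Σ be a homomorphism of inverse semigroups and let K = { s ∈ S : φ(s) ∈ E(Σ) }. If u, v ∈ S satisfy u u⁻¹ ≃_K v v⁻¹ and φ(u) = φ(v), then u ≃_K v. (This expresses that the induced functor S//K → Σ is star-injective.) -/

import Mathlib

/-- An inverse semigroup: a semigroup in which every element `s` has a
(unique) inverse `s⁻¹` with `s * s⁻¹ * s = s` and `s⁻¹ * s * s⁻¹ = s⁻¹`. -/
class InverseSemigroup (S : Type*) extends Semigroup S, Inv S where
  mul_inv_mul : ∀ s : S, s * s⁻¹ * s = s
  inv_mul_inv : ∀ s : S, s⁻¹ * s * s⁻¹ = s⁻¹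
  inv_unique : ∀ s t : S, s * t * s = s → t * s * t = t → t = s⁻¹

/-- The natural partial order on an inverse semigroup:
`s ≤ t` iff `s = e * t` for some idempotent `e`. -/
def NatLe {S : Type*} [InverseSemigroup S] (s t : S) : Prop :=
  ∃ e : S, IsIdempotentElem e ∧ s = e * t

/-- A normal inverse subsemigroup: a full inverse subsemigroup that is
closed under conjugation. -/
structure IsNormalInverseSubsemigroup {S : Type*} [InverseSemigroup S] (N : Set S) : Prop where
  mul_mem : ∀ {a b : S}, a ∈ N → b ∈ N → a * b ∈ N
  inv_mem : ∀ {a : S}, a ∈ N → a⁻¹ ∈ N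
  full : ∀ {e : S}, IsIdempotentElem e → e ∈ N
  conj_mem : ∀ (s : S) {n : S}, n ∈ N → s⁻¹ * n * s ∈ N

/-- The preorder `≤_N` associated to a normal inverse subsemigroup `N`:
`s ≤_N t` iff there are `a, b ∈ N` with `a⁻¹ * a = s * s⁻¹`,
`s⁻¹ * s = b * b⁻¹` (so `a · s · b` is a trace product) and `a * s * b ≤ t`. -/
def LeN {S : Type*} [InverseSemigroup S] (N : Set S) (s t : S) : Prop :=
  ∃ a ∈ N, ∃ b ∈ N, a⁻¹ * a = s * s⁻¹ ∧ s⁻¹ * s = b * b⁻¹ ∧ NatLe (a * s * b) t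

/-- The equivalence `≃_N` obtained by symmetrizing `≤_N`. -/
def SimeqN {S : Type*} [InverseSemigroup S] (N : Set S) (s t : S) : Prop :=
  LeN N s t ∧ LeN N t s

namespace InverseSemigroup

variable {S T : Type*} [InverseSemigroup S] [InverseSemigroup T]

theorem inv_inv (s : S) : s⁻¹⁻¹ = s :=
  (inv_unique _ _ (inv_mul_inv s) (mul_inv_mul s)).symm

theorem inv_eq_self_of_isIdempotentElem {e : S} (he : IsIdempotentElem e) : e⁻¹ = e :=
  (inv_unique e e (by rw [he.eq, he.eq]) (by rw [he.eq, he.eq])).symm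

theorem isIdempotentElem_mul_inv (s : S) : IsIdempotentElem (s * s⁻¹) := by
  rw [IsIdempotentElem, ← mul_assoc, mul_inv_mul]

theorem isIdempotentElem_mul {e f : S} (he : IsIdempotentElem e) (hf : IsIdempotentElem f) :
    IsIdempotentElem (e * f) := by
  have h₁ := mul_inv_mul (e * f)
  have h₂ := inv_mul_inv (e * f)
  set x := (e * f)⁻¹ with hx
  have hfxe : f * x * e = x := by
    apply inv_unique (e * f)
    · calc e * f * (f * x * e) * (e * f) = e * (f * f) * x * ((e * e) * f) := by
            simp only [mul_assoc]
        _ = e * f := by rw [he.eq, hf.eq, h₁]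
    · calc f * x * e * (e * f) * (f * x * e) = f * (x * ((e * e) * (f * f)) * x) * e := by
            simp only [mul_assoc]
        _ = f * x * e := by rw [he.eq, hf.eq, h₂]
  have hxx : IsIdempotentElem x := by
    calc x * x = (f * x * e) * (f * x * e) := by rw [hfxe]
      _ = f * (x * (e * f) * x) * e := by simp only [mul_assoc]
      _ = x := by rw [h₂, hfxe]
  have : x = e * f := by rw [← inv_eq_self_of_isIdempotentElem hxx, hx, inv_inv]
  rwa [← this]

theorem mul_comm_of_isIdempotentElem {e f : S} (he : IsIdempotentElem e)
    (hf : IsIdempotentElem f) : e * f = f * e := by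
  have key : ∀ {e f : S}, IsIdempotentElem e → IsIdempotentElem f →
      e * f * (f * e) * (e * f) = e * f := fun {e f} he hf => by
    calc e * f * (f * e) * (e * f) = e * (f * f) * ((e * e) * f) := by simp only [mul_assoc]
      _ = e * f := by rw [he.eq, hf.eq, (isIdempotentElem_mul he hf).eq]
  rw [inv_unique _ _ (key he hf) (key hf he),
    inv_eq_self_of_isIdempotentElem (isIdempotentElem_mul he hf)]

theorem mul_inv_rev (s t : S) : (s * t)⁻¹ = t⁻¹ * s⁻¹ := by
  have key : ∀ s t : S, s * t * (t⁻¹ * s⁻¹) * (s * t) = s * t := fun s t => by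
    have hs : IsIdempotentElem (s⁻¹ * s) := by
      simpa only [inv_inv] using isIdempotentElem_mul_inv s⁻¹
    calc s * t * (t⁻¹ * s⁻¹) * (s * t) = s * ((t * t⁻¹) * (s⁻¹ * s)) * t := by
          simp only [mul_assoc]
      _ = s * s⁻¹ * s * (t * t⁻¹ * t) := by
          rw [mul_comm_of_isIdempotentElem (isIdempotentElem_mul_inv t) hs]
          simp only [mul_assoc]
      _ = s * t := by rw [mul_inv_mul, mul_inv_mul]
  refine (inv_unique _ _ (key s t) ?_).symm
  simpa only [inv_inv] using key t⁻¹ s⁻¹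

theorem map_inv_of_map_mul {φ : S → T} (hφ : ∀ a b : S, φ (a * b) = φ a * φ b) (s : S) :
    φ s⁻¹ = (φ s)⁻¹ :=
  inv_unique _ _ (by rw [← hφ, ← hφ, mul_inv_mul]) (by rw [← hφ, ← hφ, inv_mul_inv])

theorem isIdempotentElem_inv_mul_mul (y : S) {x : S} (hx : IsIdempotentElem x) :
    IsIdempotentElem (y⁻¹ * x * y) := by
  calc y⁻¹ * x * y * (y⁻¹ * x * y) = y⁻¹ * (x * (y * y⁻¹)) * x * y := by simp only [mul_assoc]
    _ = (y⁻¹ * y * y⁻¹) * (x * x) * y := by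
        rw [mul_comm_of_isIdempotentElem hx (isIdempotentElem_mul_inv y)]
        simp only [mul_assoc]
    _ = y⁻¹ * x * y := by rw [inv_mul_inv, hx.eq]

theorem mul_eq_self_of_natLe {p f : S} (hf : IsIdempotentElem f) (h : NatLe p f) :
    f * p = p := by
  obtain ⟨g, hg, rfl⟩ := h
  rw [mul_comm_of_isIdempotentElem hg hf, ← mul_assoc, hf.eq]

theorem leN_of_leN_mul_inv {φ : S → T} (hφ : ∀ a b : S, φ (a * b) = φ a * φ b) {u v : S}
    (h : LeN {s : S | IsIdempotentElem (φ s)} (u * u⁻¹) (v * v⁻¹)) (huv : φ u = φ v) :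
    LeN {s : S | IsIdempotentElem (φ s)} u v := by
  obtain ⟨a, ha, b, -, hau, hub, hle⟩ := h
  have hu := isIdempotentElem_mul_inv u
  rw [inv_eq_self_of_isIdempotentElem hu, hu.eq] at hau hub
  have haa : a * (u * u⁻¹) = a := by rw [← hau, ← mul_assoc, mul_inv_mul]
  rw [haa] at hle
  have hva : v * v⁻¹ * a = a := by
    have hab : a * b * b⁻¹ = a := by rw [mul_assoc, ← hub, haa]
    rw [← hab, ← mul_assoc, mul_eq_self_of_natLe (isIdempotentElem_mul_inv v) hle]
  refine ⟨a, ha, u⁻¹ * a⁻¹ * v, ?_, hau, ?_, a * a⁻¹, isIdempotentElem_mul_inv a, ?_⟩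
  · rw [Set.mem_ofPred_eq] at ha ⊢
    rw [hφ, hφ, map_inv_of_map_mul hφ, map_inv_of_map_mul hφ, ← huv,
      inv_eq_self_of_isIdempotentElem ha]
    exact isIdempotentElem_inv_mul_mul _ ha
  · symm
    calc u⁻¹ * a⁻¹ * v * (u⁻¹ * a⁻¹ * v)⁻¹ = u⁻¹ * a⁻¹ * (v * v⁻¹ * a) * u := by
          simp only [mul_inv_rev, inv_inv, mul_assoc]
      _ = u⁻¹ * (a⁻¹ * a) * u := by rw [hva]; simp only [mul_assoc]
      _ = u⁻¹ * u := by rw [hau, ← mul_assoc, inv_mul_inv]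
  · calc a * u * (u⁻¹ * a⁻¹ * v) = a * (u * u⁻¹) * a⁻¹ * v := by simp only [mul_assoc]
      _ = a * a⁻¹ * v := by rw [haa]

end InverseSemigroup

/-- The induced functor `S // K → Σ` is star-injective: if `u u⁻¹ ≃_K v v⁻¹`
and `φ u = φ v` then `u ≃_K v`. -/
theorem induced_functor_star_injective {S T : Type*} [InverseSemigroup S] [InverseSemigroup T]
    (φ : S → T) (hφ : ∀ a b : S, φ (a * b) = φ a * φ b) (u v : S)
    (h1 : SimeqN {s : S | IsIdempotentElem (φ s)} (u * u⁻¹) (v * v⁻¹))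
    (h2 : φ u = φ v) :
    SimeqN {s : S | IsIdempotentElem (φ s)} u v :=
  ⟨InverseSemigroup.leN_of_leN_mul_inv hφ h1.1 h2,
    InverseSemigroup.leN_of_leN_mul_inv hφ h1.2 h2.symm⟩
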